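/- (Sufficiently large penalties force a partition) Let N, L be positive natural numbers, a : Fin N → Fin L → ℝ with a_{ij} ∈ {0, 1}, ξ : Fin L → ℝ with ξ_j ≥ 0 for all j, c : Fin N → ℝ, and l ∈ ℝ. Assume c_i > ∑_{j=1}^{L} ξ_j for every i. Assume there exists a zero-slack feasible solution: z⁰ : Fin L → {0,1} with ∑_j a_{ij} z⁰_j = 1 for all i and ∑_j z⁰_j ≤ l. Then every optimal solution (z*, s*) of the MIP (i.e., z*_j ∈ {0,1}, s*_i ≥ 0, ∑_j a_{ij} z*_j + s*_i = 1 for all i, ∑_j z*_j ≤ l, and (z*, s*) minimizes ∑_j ξ_j z_j + ∑_i c_i s_i over all such feasible solutions) satisfies s*_i = 0 for all i; consequently every sample is covered by exactly one selected rule: for each i, ∑_j a_{ij} z*_j = 1. -/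

import Mathlib

/-- A nonnegative slack that completes a sum of binary terms to `1` is itself binary. -/
theorem slack_eq_zero_or_one {ι : Type*} [Fintype ι] {u : ι → ℝ} {s : ℝ}
    (hu : ∀ j, u j = 0 ∨ u j = 1) (hs : 0 ≤ s) (h : ∑ j, u j + s = 1) : s = 0 ∨ s = 1 := by
  by_cases hall : ∀ j, u j = 0
  · right
    simpa [hall] using h
  · left
    push Not at hall
    obtain ⟨j, hj⟩ := hall
    have hle : u j ≤ ∑ k, u k :=
      Finset.single_le_sum (fun k _ => by rcases hu k with h | h <;> simp [h]) (Finset.mem_univ j)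
    rw [(hu j).resolve_left hj] at hle
    linarith

/-- Sufficiently large penalties force a partition: if `c i > ∑ j, ξ j` for
all `i` and a zero-slack feasible solution exists, then every optimal MIP
solution has zero slacks, so every sample is covered by exactly one rule. -/
theorem large_penalty_forces_partition (N L : ℕ) (hN : 0 < N) (hL : 0 < L)
    (a : Fin N → Fin L → ℝ) (ha : ∀ i j, a i j = 0 ∨ a i j = 1)
    (ξ : Fin L → ℝ) (hξ : ∀ j, 0 ≤ ξ j)
    (c : Fin N → ℝ) (hc : ∀ i, (∑ j, ξ j) < c i) (l : ℝ)
    (z0 : Fin L → ℝ) (hz0bin : ∀ j, z0 j = 0 ∨ z0 j = 1)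
    (hz0cov : ∀ i, (∑ j, a i j * z0 j) = 1) (hz0card : ∑ j, z0 j ≤ l)
    (zstar : Fin L → ℝ) (sstar : Fin N → ℝ)
    (hzbin : ∀ j, zstar j = 0 ∨ zstar j = 1) (hsnn : ∀ i, 0 ≤ sstar i)
    (hcov : ∀ i, (∑ j, a i j * zstar j) + sstar i = 1)
    (hcard : ∑ j, zstar j ≤ l)
    (hopt : ∀ (z : Fin L → ℝ) (s : Fin N → ℝ),
      (∀ j, z j = 0 ∨ z j = 1) → (∀ i, 0 ≤ s i) →
      (∀ i, (∑ j, a i j * z j) + s i = 1) → (∑ j, z j ≤ l) →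
      (∑ j, ξ j * zstar j) + (∑ i, c i * sstar i) ≤
        (∑ j, ξ j * z j) + ∑ i, c i * s i) :
    (∀ i, sstar i = 0) ∧ ∀ i, (∑ j, a i j * zstar j) = 1 := by
  have hξ_sum : 0 ≤ ∑ j, ξ j := Finset.sum_nonneg fun j _ => hξ j
  have hslack : ∀ i, sstar i = 0 := by
    intro i
    have hterm : ∀ j, a i j * zstar j = 0 ∨ a i j * zstar j = 1 := by
      intro j
      rcases ha i j with h | h <;> rcases hzbin j with h' | h' <;> simp [h, h']
    refine (slack_eq_zero_or_one hterm (hsnn i) (hcov i)).resolve_right fun hone => ?_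
    have hle := hopt z0 0 hz0bin (by simp) (by simpa using hz0cov) hz0card
    have hz0 : ∑ j, ξ j * z0 j ≤ ∑ j, ξ j := by
      refine Finset.sum_le_sum fun j _ => ?_
      rcases hz0bin j with h | h <;> simp [h, hξ j]
    have hzstar : 0 ≤ ∑ j, ξ j * zstar j := by
      refine Finset.sum_nonneg fun j _ => mul_nonneg (hξ j) ?_
      rcases hzbin j with h | h <;> simp [h]
    have hpen : c i * sstar i ≤ ∑ k, c k * sstar k :=
      Finset.single_le_sum (f := fun k => c k * sstar k)
        (fun k _ => mul_nonneg (hξ_sum.trans (hc k).le) (hsnn k)) (Finset.mem_univ i)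
    rw [hone, mul_one] at hpen
    simp only [Pi.zero_apply, mul_zero, Finset.sum_const_zero, add_zero] at hle
    linarith [hc i]
  exact ⟨hslack, fun i => by simpa [hslack i] using hcov i⟩
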